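/- (Existence of Kozak–Simonenko polygons.) For every r > 0 and R > 0 the set 𝔐(r, R) is nonempty; moreover there exists a sequence of convex lattice polygons Π_n ∈ 𝔐(r, R), n ∈ ℕ, which tends to ℝ², in the sense that for every bounded set K ⊂ ℝ² there is an N such that K ⊆ Π_n for all n ≥ N. -/

import Mathlib

/-!
Statement 14 (Existence of Kozak–Simonenko polygons):
For every `r > 0` and `R > 0` the class `𝔐(r,R)` of convex lattice polygons is nonempty;
moreover there is a sequence `Π_n ∈ 𝔐(r,R)` tending to `ℝ²` (every bounded set is
eventually contained in `Π_n`).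
-/

noncomputable section

/-- The embedding of the lattice `ℤ²` into the Euclidean plane. -/
def latticeCoe (k : Fin 2 → ℤ) : EuclideanSpace ℝ (Fin 2) :=
  (WithLp.equiv 2 (Fin 2 → ℝ)).symm fun i => (k i : ℝ)

/-- `M ⊆ ℤ²` is a canonical discrete half-space if both `M` and its complement are closed
under addition. -/
def IsCanonicalDiscreteHalfSpace (M : Set (Fin 2 → ℤ)) : Prop :=
  (∀ x ∈ M, ∀ y ∈ M, x + y ∈ M) ∧ (∀ x ∉ M, ∀ y ∉ M, x + y ∉ M)

/-- `M ⊆ ℤ²` is a discrete half-space if some translate `M + j` is a canonical discrete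
half-space. -/
def IsDiscreteHalfSpace (M : Set (Fin 2 → ℤ)) : Prop :=
  ∃ j : Fin 2 → ℤ, IsCanonicalDiscreteHalfSpace ((fun x => x + j) '' M)

/-- A convex lattice polygon: the convex hull of a finite set of lattice points. -/
def IsConvexLatticePolygon (P : Set (EuclideanSpace ℝ (Fin 2))) : Prop :=
  ∃ F : Finset (Fin 2 → ℤ), P = convexHull ℝ (latticeCoe '' ↑F)

/-- Membership in the Kozak–Simonenko class `𝔐(r,R)`: a convex lattice polygon `P` such
that (i) near every point `x` of the plane, the lattice points of `P` in `B(x,r)` coincide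
with those of some discrete half-space, and (ii) `P ⊇ B(0,R)`. -/
def MemKS (r R : ℝ) (P : Set (EuclideanSpace ℝ (Fin 2))) : Prop :=
  IsConvexLatticePolygon P ∧
  (∀ x : EuclideanSpace ℝ (Fin 2), ∃ M : Set (Fin 2 → ℤ), IsDiscreteHalfSpace M ∧
    {k : Fin 2 → ℤ | latticeCoe k ∈ P ∧ latticeCoe k ∈ Metric.ball x r}
      = {k : Fin 2 → ℤ | k ∈ M ∧ latticeCoe k ∈ Metric.ball x r}) ∧
  Metric.ball (0 : EuclideanSpace ℝ (Fin 2)) R ⊆ P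

/-- Recursive corner cutting. -/
def CC (V : ℕ) : ℕ → ℝ → ℝ → Prop
  | 0, a, b => a ≤ 0 ∧ b ≤ 0
  | d + 1, a, b => CC V d a (a + b + 3 * V * 4 ^ d) ∧ CC V d (a + b + 3 * V * 4 ^ d) b

theorem CC_le (V : ℕ) : ∀ (d : ℕ) (a b : ℝ), CC V d a b → a ≤ 0 ∧ b ≤ 0
  | 0, _, _, h => h
  | d + 1, _, _, h => ⟨(CC_le V d _ _ h.1).1, (CC_le V d _ _ h.2).2⟩

theorem CC_far (V : ℕ) : ∀ (d : ℕ) (a b : ℝ),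
    ((a ≤ 0 ∧ b ≤ -(V * 4 ^ d)) ∨ (b ≤ 0 ∧ a ≤ -(V * 4 ^ d))) → CC V d a b
  | 0, a, b, h => by
      have hV : (0 : ℝ) ≤ V := Nat.cast_nonneg V
      simp only [pow_zero, mul_one] at h
      refine ⟨?_, ?_⟩ <;> rcases h with h | h <;> linarith [h.1, h.2]
  | d + 1, a, b, h => by
      have hV : (0 : ℝ) ≤ V * 4 ^ d := by positivity
      have e : (V : ℝ) * 4 ^ (d + 1) = 4 * (V * 4 ^ d) := by ring
      have e3 : (3 : ℝ) * V * 4 ^ d = 3 * (V * 4 ^ d) := by ring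
      rw [e] at h
      simp only [CC]
      rw [e3]
      rcases h with ⟨h1, h2⟩ | ⟨h1, h2⟩
      · exact ⟨CC_far V d _ _ (Or.inl ⟨h1, by linarith⟩),
          CC_far V d _ _ (Or.inl ⟨by linarith, by linarith⟩)⟩
      · exact ⟨CC_far V d _ _ (Or.inr ⟨by linarith, by linarith⟩),
          CC_far V d _ _ (Or.inr ⟨h1, by linarith⟩)⟩

theorem CC_convex (V : ℕ) : ∀ (d : ℕ) (a b a' b' p q : ℝ), 0 ≤ p → 0 ≤ q → p + q = 1 →
    CC V d a b → CC V d a' b' → CC V d (p * a + q * a') (p * b + q * b')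
  | 0, a, b, a', b', p, q, hp, hq, hpq, h, h' => by
      refine ⟨?_, ?_⟩
      · nlinarith [h.1, h'.1, mul_nonneg hp (neg_nonneg.2 h.1), mul_nonneg hq (neg_nonneg.2 h'.1)]
      · nlinarith [h.2, h'.2, mul_nonneg hp (neg_nonneg.2 h.2), mul_nonneg hq (neg_nonneg.2 h'.2)]
  | d + 1, a, b, a', b', p, q, hp, hq, hpq, h, h' => by
      have e : p * a + q * a' + (p * b + q * b') + 3 * V * 4 ^ d
          = p * (a + b + 3 * V * 4 ^ d) + q * (a' + b' + 3 * V * 4 ^ d) := by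
        have : (3 : ℝ) * V * 4 ^ d = (p + q) * (3 * V * 4 ^ d) := by rw [hpq, one_mul]
        linear_combination this
      simp only [CC]
      rw [e]
      exact ⟨CC_convex V d _ _ _ _ _ _ hp hq hpq h.1 h'.1,
        CC_convex V d _ _ _ _ _ _ hp hq hpq h.2 h'.2⟩

theorem dhs_empty : IsDiscreteHalfSpace (∅ : Set (Fin 2 → ℤ)) :=
  ⟨0, by simp [IsCanonicalDiscreteHalfSpace]⟩

theorem dhs_lex (L L' : (Fin 2 → ℤ) → ℤ) (hL : ∀ k l, L (k + l) = L k + L l)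
    (hL' : ∀ k l, L' (k + l) = L' k + L' l) (c c' : ℤ)
    (hj : ∃ j, L j = -c ∧ L' j = -c') :
    IsDiscreteHalfSpace {k | L k - c < 0 ∨ (L k - c = 0 ∧ L' k - c' ≤ 0)} := by
  obtain ⟨j, h1, h2⟩ := hj
  refine ⟨j, ?_⟩
  have e : (fun x => x + j) '' {k | L k - c < 0 ∨ (L k - c = 0 ∧ L' k - c' ≤ 0)}
      = {k | L k < 0 ∨ (L k = 0 ∧ L' k ≤ 0)} := by
    ext k
    constructor
    · rintro ⟨x, hx, rfl⟩
      simp only [Set.mem_ofPred_eq, hL, hL', h1, h2] at hx ⊢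
      omega
    · intro hk
      refine ⟨k - j, ?_, by simp⟩
      have a1 := hL (k - j) j
      have a2 := hL' (k - j) j
      rw [sub_add_cancel] at a1 a2
      simp only [Set.mem_ofPred_eq] at hk ⊢
      omega
  rw [e]
  constructor <;> intro x hx y hy <;> simp only [Set.mem_ofPred_eq, hL, hL'] at * <;> omega

theorem corner_local (V : ℕ) (ρ : ℝ) (hρ : 0 ≤ ρ) (W : Set (Fin 2 → ℤ))
    (X Y : (Fin 2 → ℤ) → ℤ) (hX : ∀ k l, X (k + l) = X k + X l)
    (hY : ∀ k l, Y (k + l) = Y k + Y l) (hs : ∀ a b, ∃ j, X j = a ∧ Y j = b)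
    (hWX : ∀ k ∈ W, ∀ l ∈ W, ((X k : ℝ) - X l) ≤ ρ)
    (hWY : ∀ k ∈ W, ∀ l ∈ W, ((Y k : ℝ) - Y l) ≤ ρ) :
    ∀ (d : ℕ) (α β γ δ c c' : ℤ), 0 ≤ α → 0 ≤ β → 0 ≤ γ → 0 ≤ δ → α * δ - β * γ = 1 →
      2 * ρ < ((α + β + γ + δ : ℤ) : ℝ) + d →
      ((α + β + γ + δ : ℤ) : ℝ) * 2 ^ d * ρ ≤ V →
      ∃ M, IsDiscreteHalfSpace M ∧ ∀ k ∈ W, (k ∈ M ↔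
        CC V d ((α * X k + β * Y k - c : ℤ) : ℝ) ((γ * X k + δ * Y k - c' : ℤ) : ℝ)) := by
  intro d
  induction d with
  | zero =>
    intro α β γ δ c c' hα hβ hγ hδ hdet hsum hV
    have hj : ∃ j, α * X j + β * Y j = -c ∧ γ * X j + δ * Y j = -c' := by
      obtain ⟨j, h1, h2⟩ := hs (-δ * c + β * c') (γ * c - α * c')
      refine ⟨j, ?_, ?_⟩ <;> rw [h1, h2]
      · linear_combination (-c) * hdet
      · linear_combination (-c') * hdet
    have l1 : ∀ k l, α * X (k + l) + β * Y (k + l) = (α * X k + β * Y k) + (α * X l + β * Y l) := by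
      intro k l; rw [hX, hY]; ring
    have l2 : ∀ k l, γ * X (k + l) + δ * Y (k + l) = (γ * X k + δ * Y k) + (γ * X l + δ * Y l) := by
      intro k l; rw [hX, hY]; ring
    by_cases hA : ∃ k ∈ W, α * X k + β * Y k - c < 0 ∧ 0 < γ * X k + δ * Y k - c'
    · refine ⟨_, dhs_lex (fun k => γ * X k + δ * Y k) (fun k => α * X k + β * Y k) l2 l1 c' c
        (by obtain ⟨j, h1, h2⟩ := hj; exact ⟨j, h2, h1⟩), ?_⟩
      intro l hl
      obtain ⟨k, hk, hk1, hk2⟩ := hA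
      have key : ¬ (0 < α * X l + β * Y l - c ∧ γ * X l + δ * Y l - c' < 0) := by
        rintro ⟨h1, h2⟩
        have a1 : 1 ≤ α * (X l - X k) + β * (Y l - Y k) := by linarith
        have a2 : 1 ≤ γ * (X k - X l) + δ * (Y k - Y l) := by linarith
        have b1 : δ + β ≤ X l - X k := by
          have : X l - X k = δ * (α * (X l - X k) + β * (Y l - Y k))
              + β * (γ * (X k - X l) + δ * (Y k - Y l)) := by
            linear_combination (-(X l - X k)) * hdet
          nlinarith
        have b2 : α + γ ≤ Y k - Y l := by
          have : Y k - Y l = γ * (α * (X l - X k) + β * (Y l - Y k))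
              + α * (γ * (X k - X l) + δ * (Y k - Y l)) := by
            linear_combination (-(Y k - Y l)) * hdet
          nlinarith
        have b3 : α + β + γ + δ ≤ (X l - X k) + (Y k - Y l) := by linarith
        have b4 : ((α + β + γ + δ : ℤ) : ℝ) ≤ ((X l : ℝ) - X k) + ((Y k : ℝ) - Y l) := by
          exact_mod_cast b3
        have := hWX l hl k hk
        have := hWY k hk l hl
        simp only [Nat.cast_zero, add_zero] at hsum
        linarith
      simp only [CC, Set.mem_ofPred_eq, Int.cast_nonpos]
      omega
    · refine ⟨_, dhs_lex (fun k => α * X k + β * Y k) (fun k => γ * X k + δ * Y k) l1 l2 c c' hj, ?_⟩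
      intro k hk
      have : ¬ (α * X k + β * Y k - c < 0 ∧ 0 < γ * X k + δ * Y k - c') := fun h => hA ⟨k, hk, h⟩
      simp only [CC, Set.mem_ofPred_eq, Int.cast_nonpos]
      omega
  | succ d ih =>
    intro α β γ δ c c' hα hβ hγ hδ hdet hsum hV
    have p1 : 1 ≤ α + β := by
      by_contra h
      have h1 : α = 0 := by omega
      have h2 : β = 0 := by omega
      subst h1 h2; simp at hdet
    have p2 : 1 ≤ γ + δ := by
      by_contra h
      have h1 : γ = 0 := by omega
      have h2 : δ = 0 := by omega
      subst h1 h2; simp at hdet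
    have q1 : (1 : ℝ) ≤ α + β := by exact_mod_cast p1
    have q2 : (1 : ℝ) ≤ γ + δ := by exact_mod_cast p2
    have r1 : (0 : ℝ) ≤ α := by exact_mod_cast hα
    have r2 : (0 : ℝ) ≤ β := by exact_mod_cast hβ
    have r3 : (0 : ℝ) ≤ γ := by exact_mod_cast hγ
    have r4 : (0 : ℝ) ≤ δ := by exact_mod_cast hδ
    have hP : (1 : ℝ) ≤ 2 ^ d := one_le_pow₀ (by norm_num)
    have hP4 : (1 : ℝ) ≤ 4 ^ d := one_le_pow₀ (by norm_num)
    have hV0 : (0 : ℝ) ≤ V := Nat.cast_nonneg V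
    have hV' : (2 * ((α : ℝ) + β + γ + δ)) * (2 ^ d * ρ) ≤ V := by
      refine le_trans (le_of_eq ?_) hV
      push_cast; ring
    have hPρ : 0 ≤ 2 ^ d * ρ := by positivity
    have hρP : ρ ≤ 2 ^ d * ρ := by nlinarith
    have hT : (V : ℝ) ≤ V * 4 ^ d := by nlinarith
    push_cast at hsum
    have ew : ∀ k, ((α * X k + β * Y k - c : ℤ) : ℝ) + ((γ * X k + δ * Y k - c' : ℤ) : ℝ)
        + 3 * V * 4 ^ d
        = (((α + γ) * X k + (β + δ) * Y k - (c + c' - 3 * V * 4 ^ d) : ℤ) : ℝ) := by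
      intro k; push_cast; ring
    by_cases h1 : ∀ k ∈ W, ((γ * X k + δ * Y k - c' : ℤ) : ℝ) ≤ -(V * 4 ^ d)
    · obtain ⟨M, hM, hk⟩ := ih α β (α + γ) (β + δ) c (c + c' - 3 * V * 4 ^ d) hα hβ
        (by omega) (by omega) (by linear_combination hdet)
        (by push_cast; linarith)
        (by
          push_cast
          rw [mul_assoc]
          exact le_trans (mul_le_mul_of_nonneg_right (by linarith) hPρ) hV')
      refine ⟨M, hM, fun k hkW => ?_⟩
      rw [hk k hkW]
      simp only [CC]
      rw [ew]
      exact ⟨fun h => ⟨h, CC_far V d _ _ (Or.inl ⟨(CC_le V d _ _ h).2, h1 k hkW⟩)⟩, fun h => h.1⟩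
    by_cases h2 : ∀ k ∈ W, ((α * X k + β * Y k - c : ℤ) : ℝ) ≤ -(V * 4 ^ d)
    · obtain ⟨M, hM, hk⟩ := ih (α + γ) (β + δ) γ δ (c + c' - 3 * V * 4 ^ d) c'
        (by omega) (by omega) hγ hδ (by linear_combination hdet)
        (by push_cast; linarith)
        (by
          push_cast
          rw [mul_assoc]
          exact le_trans (mul_le_mul_of_nonneg_right (by linarith) hPρ) hV')
      refine ⟨M, hM, fun k hkW => ?_⟩
      rw [hk k hkW]
      simp only [CC]
      rw [ew]
      exact ⟨fun h => ⟨CC_far V d _ _ (Or.inr ⟨(CC_le V d _ _ h).1, h2 k hkW⟩), h⟩, fun h => h.2⟩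
    push Not at h1 h2
    obtain ⟨k1, hk1, e1⟩ := h1
    obtain ⟨k2, hk2, e2⟩ := h2
    refine ⟨∅, dhs_empty, fun k hk => ?_⟩
    simp only [Set.mem_empty_iff_false, false_iff]
    intro h
    have hw := (CC_le V d _ _ h.1).2
    push_cast at e1 e2 hw
    have a1 := mul_le_mul_of_nonneg_left (hWX k1 hk1 k hk) r3
    have a2 := mul_le_mul_of_nonneg_left (hWY k1 hk1 k hk) r4
    have a3 := mul_le_mul_of_nonneg_left (hWX k2 hk2 k hk) r1
    have a4 := mul_le_mul_of_nonneg_left (hWY k2 hk2 k hk) r2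
    have a5 : ((α : ℝ) + β + γ + δ) * ρ ≤ V := by
      refine le_trans ?_ hV'
      have : ((α : ℝ) + β + γ + δ) * ρ ≤ ((α : ℝ) + β + γ + δ) * (2 ^ d * ρ) :=
        mul_le_mul_of_nonneg_left hρP (by linarith)
      have : 0 ≤ ((α : ℝ) + β + γ + δ) * (2 ^ d * ρ) := mul_nonneg (by linarith) hPρ
      linarith
    nlinarith

/-- The full body: all four corners. -/
def KK (V d : ℕ) (s x y : ℝ) : Prop :=
  CC V d (x - s) (y - s) ∧ CC V d (-x - s) (y - s) ∧
    CC V d (x - s) (-y - s) ∧ CC V d (-x - s) (-y - s)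

theorem KK_negx (V d : ℕ) (s x y : ℝ) : KK V d s (-x) y ↔ KK V d s x y := by
  simp only [KK, neg_neg]; tauto

theorem KK_negy (V d : ℕ) (s x y : ℝ) : KK V d s x (-y) ↔ KK V d s x y := by
  simp only [KK, neg_neg]; tauto

theorem KK_red (V d : ℕ) (s x y : ℝ) (hx : -x - s ≤ -(V * 4 ^ d)) (hy : -y - s ≤ -(V * 4 ^ d)) :
    KK V d s x y ↔ CC V d (x - s) (y - s) := by
  have hT : (0 : ℝ) ≤ V * 4 ^ d := by positivity
  refine ⟨fun h => h.1, fun h => ⟨h, ?_, ?_, ?_⟩⟩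
  · exact CC_far _ _ _ _ (Or.inr ⟨(CC_le _ _ _ _ h).2, hx⟩)
  · exact CC_far _ _ _ _ (Or.inl ⟨(CC_le _ _ _ _ h).1, hy⟩)
  · exact CC_far _ _ _ _ (Or.inl ⟨by linarith, hy⟩)

theorem KK_convex (V d : ℕ) (s x y x' y' p q : ℝ) (hp : 0 ≤ p) (hq : 0 ≤ q) (hpq : p + q = 1)
    (h : KK V d s x y) (h' : KK V d s x' y') : KK V d s (p * x + q * x') (p * y + q * y') := by
  have e : ∀ a b : ℝ, p * a + q * b - s = p * (a - s) + q * (b - s) := by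
    intro a b; linear_combination s * hpq
  have e' : ∀ a b : ℝ, -(p * a + q * b) - s = p * (-a - s) + q * (-b - s) := by
    intro a b; linear_combination s * hpq
  simp only [KK]
  rw [e, e, e', e']
  exact ⟨CC_convex _ _ _ _ _ _ _ _ hp hq hpq h.1 h'.1,
    CC_convex _ _ _ _ _ _ _ _ hp hq hpq h.2.1 h'.2.1,
    CC_convex _ _ _ _ _ _ _ _ hp hq hpq h.2.2.1 h'.2.2.1,
    CC_convex _ _ _ _ _ _ _ _ hp hq hpq h.2.2.2 h'.2.2.2⟩

theorem KK_local (V D : ℕ) (ρ : ℝ) (hρ : 0 ≤ ρ) (hD : 2 * ρ < D) (hV : 2 * 2 ^ D * ρ ≤ V)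
    (s : ℤ) (hs : V * 4 ^ D + ρ ≤ s) (W : Set (Fin 2 → ℤ))
    (hW : ∀ i, ∀ k ∈ W, ∀ l ∈ W, ((k i : ℝ) - l i) ≤ ρ) :
    ∃ M, IsDiscreteHalfSpace M ∧ ∀ k ∈ W, (k ∈ M ↔ KK V D s (k 0) (k 1)) := by
  have main : ∀ σ τ : ℤ, (σ = 1 ∨ σ = -1) → (τ = 1 ∨ τ = -1) →
      ∃ M, IsDiscreteHalfSpace M ∧ ∀ k ∈ W, (k ∈ M ↔
        CC V D ((σ * k 0 : ℤ) - s : ℝ) ((τ * k 1 : ℤ) - s : ℝ)) := by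
    intro σ τ hσ hτ
    obtain ⟨M, hM, h⟩ := corner_local V ρ hρ W (fun k => σ * k 0) (fun k => τ * k 1)
      (fun k l => by simp [mul_add]) (fun k l => by simp [mul_add])
      (fun a b => ⟨![σ * a, τ * b], by rcases hσ with rfl | rfl <;> simp,
        by rcases hτ with rfl | rfl <;> simp⟩)
      (fun k hk l hl => by
        rcases hσ with rfl | rfl
        · simpa using hW 0 k hk l hl
        · have := hW 0 l hl k hk
          push_cast; linarith)
      (fun k hk l hl => by
        rcases hτ with rfl | rfl
        · simpa using hW 1 k hk l hl
        · have := hW 1 l hl k hk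
          push_cast; linarith)
      D 1 0 0 1 s s (by norm_num) (by norm_num) (by norm_num) (by norm_num) (by norm_num)
      (by push_cast; linarith) (by push_cast; linarith)
    refine ⟨M, hM, fun k hk => ?_⟩
    rw [h k hk]
    simp
  have side : ∀ i, ∃ σ : ℤ, (σ = 1 ∨ σ = -1) ∧
      ∀ k ∈ W, -((σ * k i : ℤ) : ℝ) - s ≤ -(V * 4 ^ D) := by
    intro i
    by_cases h : ∀ k ∈ W, -(k i : ℝ) - s ≤ -(V * 4 ^ D)
    · exact ⟨1, Or.inl rfl, fun k hk => by simpa using h k hk⟩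
    · push Not at h
      obtain ⟨l, hl, hl'⟩ := h
      refine ⟨-1, Or.inr rfl, fun k hk => ?_⟩
      have := hW i k hk l hl
      push_cast
      linarith
  obtain ⟨σ, hσ, h0⟩ := side 0
  obtain ⟨τ, hτ, h1⟩ := side 1
  obtain ⟨M, hM, h⟩ := main σ τ hσ hτ
  refine ⟨M, hM, fun k hk => ?_⟩
  rw [h k hk, ← KK_red V D s _ _ (h0 k hk) (h1 k hk)]
  rcases hσ with rfl | rfl <;> rcases hτ with rfl | rfl <;> simp [KK_negx, KK_negy]

theorem square_sub (P : Set (EuclideanSpace ℝ (Fin 2))) (hP : Convex ℝ P) (m : ℝ) (hm : 0 < m)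
    (h1 : !₂[m, m] ∈ P) (h2 : !₂[-m, m] ∈ P) (h3 : !₂[m, -m] ∈ P) (h4 : !₂[-m, -m] ∈ P)
    (x : EuclideanSpace ℝ (Fin 2)) (hx : ∀ i, |x i| ≤ m) : x ∈ P := by
  have hx0 := abs_le.1 (hx 0)
  have hx1 := abs_le.1 (hx 1)
  have w : ∀ t : ℝ, (m - t) / (2 * m) + (m + t) / (2 * m) = 1 := by
    intro t; field_simp; ring
  have v : ∀ t : ℝ, (m - t) / (2 * m) * (-m) + (m + t) / (2 * m) * m = t := by
    intro t; field_simp; ring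
  have step : ∀ b : ℝ, !₂[-m, b] ∈ P → !₂[m, b] ∈ P → !₂[x 0, b] ∈ P := by
    intro b ha hb
    have := hP ha hb (a := (m - x 0) / (2 * m)) (b := (m + x 0) / (2 * m))
      (div_nonneg (by linarith) (by linarith)) (div_nonneg (by linarith) (by linarith)) (w _)
    convert this using 1
    ext i
    fin_cases i
    · simpa using (v (x 0)).symm
    · have := w (x 0)
      simp
      linear_combination (-b) * this
  have ha := step _ h4 h3
  have hb := step _ h2 h1
  have := hP ha hb (a := (m - x 1) / (2 * m)) (b := (m + x 1) / (2 * m))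
      (div_nonneg (by linarith) (by linarith)) (div_nonneg (by linarith) (by linarith)) (w _)
  convert this using 1
  ext i
  fin_cases i
  · have := w (x 1)
    simp
    linear_combination (-(x 0)) * this
  · simpa using (v (x 1)).symm

/-- Lattice points of the body. -/
def KL (V D : ℕ) (s : ℤ) : Set (Fin 2 → ℤ) := {k | KK V D s (k 0) (k 1)}

theorem KL_finite (V D : ℕ) (s : ℤ) : (KL V D s).Finite := by
  refine (Set.finite_Icc (fun _ => -s : Fin 2 → ℤ) (fun _ => s)).subset ?_
  intro k hk
  have a := CC_le _ _ _ _ hk.1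
  have b := CC_le _ _ _ _ hk.2.2.2
  have a1 : (k 0 : ℝ) ≤ s := by linarith [a.1]
  have a2 : (k 1 : ℝ) ≤ s := by linarith [a.2]
  have b1 : (-s : ℝ) ≤ k 0 := by linarith [b.1]
  have b2 : (-s : ℝ) ≤ k 1 := by linarith [b.2]
  constructor <;> intro i <;> fin_cases i
  · exact_mod_cast b1
  · exact_mod_cast b2
  · exact_mod_cast a1
  · exact_mod_cast a2

theorem latticeCoe_apply (k : Fin 2 → ℤ) (i : Fin 2) : latticeCoe k i = k i := rfl

theorem hull_iff (V D : ℕ) (s : ℤ) (k : Fin 2 → ℤ) :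
    latticeCoe k ∈ convexHull ℝ (latticeCoe '' KL V D s) ↔ KK V D s (k 0) (k 1) := by
  constructor
  · intro h
    have hc : Convex ℝ {x : EuclideanSpace ℝ (Fin 2) | KK V D s (x 0) (x 1)} := by
      intro x hx y hy p q hp hq hpq
      exact KK_convex V D s _ _ _ _ p q hp hq hpq hx hy
    have := convexHull_min (s := latticeCoe '' KL V D s) (by
      rintro _ ⟨l, hl, rfl⟩
      exact hl) hc h
    exact this
  · intro h
    exact subset_convexHull _ _ ⟨k, h, rfl⟩

theorem hull_square (V D : ℕ) (s : ℤ) (m : ℕ) (hm : 0 < m) (hs : s = V * 4 ^ D + m)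
    (x : EuclideanSpace ℝ (Fin 2)) (hx : ‖x‖ ≤ m) :
    x ∈ convexHull ℝ (latticeCoe '' KL V D s) := by
  have hT : (0 : ℝ) ≤ V * 4 ^ D := by positivity
  have hm' : (0 : ℝ) < m := by exact_mod_cast hm
  have hs' : (s : ℝ) = V * 4 ^ D + m := by rw [hs]; push_cast; ring
  have c0 : KK V D s m m := by
    rw [KK_red]
    · exact CC_far _ _ _ _ (Or.inl ⟨by linarith, by linarith⟩)
    · linarith
    · linarith
  have mem : ∀ a b : ℤ, KK V D s a b →
      !₂[(a : ℝ), (b : ℝ)] ∈ convexHull ℝ (latticeCoe '' KL V D s) := by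
    intro a b h
    have := (hull_iff V D s ![a, b]).2 (by simpa using h)
    convert this using 1
    ext i
    fin_cases i <;> simp [latticeCoe_apply]
  refine square_sub _ (convex_convexHull _ _) m hm' ?_ ?_ ?_ ?_ x
    (fun i => le_trans (by simpa using PiLp.norm_apply_le x i) hx)
  · simpa using mem m m (by simpa using c0)
  · simpa using mem (-m) m (by simpa [KK_negx] using c0)
  · simpa using mem m (-m) (by simpa [KK_negy] using c0)
  · simpa using mem (-m) (-m) (by simpa [KK_negx, KK_negy] using c0)

theorem kozak_simonenko_polygons_exist
    (r R : ℝ) (hr : 0 < r) (hR : 0 < R) :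
    ∃ P : ℕ → Set (EuclideanSpace ℝ (Fin 2)),
      (∀ n, MemKS r R (P n)) ∧
      (∀ K : Set (EuclideanSpace ℝ (Fin 2)), Bornology.IsBounded K →
        ∃ N : ℕ, ∀ n ≥ N, K ⊆ P n) := by
  obtain ⟨D, hD⟩ := exists_nat_gt (2 * (2 * r))
  obtain ⟨V, hV⟩ := exists_nat_ge (2 * 2 ^ D * (2 * r))
  obtain ⟨m, hm⟩ := exists_nat_ge (2 * r + R)
  have hm0 : (0 : ℝ) < m := by linarith
  have hm1 : 0 < m := by exact_mod_cast hm0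
  refine ⟨fun n => convexHull ℝ (latticeCoe '' KL V D (V * 4 ^ D + (m + n : ℕ))), ?_, ?_⟩
  · intro n
    refine ⟨⟨(KL_finite V D (V * 4 ^ D + (m + n : ℕ))).toFinset, by rw [Set.Finite.coe_toFinset]⟩, ?_, ?_⟩
    · intro x
      obtain ⟨M, hM, h⟩ := KK_local V D (2 * r) (by linarith) hD hV
        (V * 4 ^ D + (m + n : ℕ)) (by
          have : (0 : ℝ) ≤ n := Nat.cast_nonneg n
          push_cast
          linarith) {k | latticeCoe k ∈ Metric.ball x r} (by
          intro i k hk l hl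
          have a1 : dist (latticeCoe k) (latticeCoe l) ≤ 2 * r := by
            have := dist_triangle_right (latticeCoe k) (latticeCoe l) x
            have h1 := Metric.mem_ball.1 hk
            have h2 := Metric.mem_ball.1 hl
            linarith
          rw [dist_eq_norm] at a1
          have a2 := PiLp.norm_apply_le (latticeCoe k - latticeCoe l) i
          have a3 := le_abs_self ((k i : ℝ) - l i)
          rw [PiLp.sub_apply, latticeCoe_apply, latticeCoe_apply, Real.norm_eq_abs] at a2
          linarith)
      refine ⟨M, hM, ?_⟩
      ext k
      simp only [Set.mem_ofPred_eq]
      constructor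
      · rintro ⟨h1, h2⟩
        exact ⟨(h k h2).2 ((hull_iff _ _ _ _).1 h1), h2⟩
      · rintro ⟨h1, h2⟩
        exact ⟨(hull_iff _ _ _ _).2 ((h k h2).1 h1), h2⟩
    · intro x hx
      refine hull_square V D _ (m + n) (by omega) rfl x ?_
      have : (0 : ℝ) ≤ n := Nat.cast_nonneg n
      have := mem_ball_zero_iff.1 hx
      push_cast
      linarith
  · intro K hK
    obtain ⟨C, hC⟩ := hK.exists_norm_le
    obtain ⟨N, hN⟩ := exists_nat_ge C
    refine ⟨N, fun n hn x hx => ?_⟩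
    refine hull_square V D _ (m + n) (by omega) rfl x ?_
    have : (N : ℝ) ≤ n := by exact_mod_cast hn
    have := hC x hx
    push_cast
    linarith

end
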